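/- Fix x ∈ ℝ and b > 0, and let s* = η(x; b) = sign(x)·(|x| − b)₊. Then the probability measures with density f_β(·; x, b) concentrate at s* as β → ∞: for every ε > 0, the f_β(·; x, b)-probability of the set {s ∈ ℝ : |s − s*| > ε} tends to 0 as β → ∞. -/

import Mathlib

open MeasureTheory Filter

/-- Soft thresholding: η(x; b) = sign(x) · max(|x| − b, 0). -/
noncomputable def softThresh (x b : ℝ) : ℝ := Real.sign x * max (|x| - b) 0

/-- Unnormalized density exp(−β|s| − (β/(2b))(s − x)²). -/
noncomputable def ampWeight (β x b s : ℝ) : ℝ :=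
  Real.exp (-β * |s| - (β / (2 * b)) * (s - x) ^ 2)

/-- Normalizing constant z_β(x, b). -/
noncomputable def ampZ (β x b : ℝ) : ℝ := ∫ s : ℝ, ampWeight β x b s

/-- First-order optimality of soft thresholding: `(x - η(x; b)) / b` is a subgradient of `|·|`
at `η(x; b)`. -/
theorem exists_subgradient_softThresh (x b : ℝ) (hb : 0 < b) :
    ∃ g : ℝ, |g| ≤ 1 ∧ g * softThresh x b = |softThresh x b| ∧ x - softThresh x b = b * g := by
  unfold softThresh
  rcases le_or_gt |x| b with h | h
  · refine ⟨x / b, ?_, ?_, ?_⟩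
    · rw [abs_div, abs_of_pos hb]
      exact (div_le_one hb).2 h
    · simp [max_eq_right (sub_nonpos.2 h)]
    · rw [max_eq_right (sub_nonpos.2 h)]
      field_simp
      ring
  · rw [max_eq_left (sub_pos.2 h).le]
    rcases lt_trichotomy x 0 with hx | hx | hx
    · rw [abs_of_neg hx] at h ⊢
      rw [Real.sign_of_neg hx]
      refine ⟨-1, by simp, ?_, by ring⟩
      rw [abs_of_neg (by linarith)]
      ring
    · rw [hx, abs_zero] at h
      linarith
    · rw [abs_of_pos hx] at h ⊢
      rw [Real.sign_of_pos hx]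
      refine ⟨1, by simp, ?_, by ring⟩
      rw [abs_of_pos (by linarith)]
      ring

/-- Quadratic growth of `s ↦ |s| + (s - x)² / (2b)` away from its minimizer. -/
theorem quadratic_growth_softThresh (x b s : ℝ) (hb : 0 < b) :
    |softThresh x b| + (softThresh x b - x) ^ 2 / (2 * b) + (s - softThresh x b) ^ 2 / (2 * b)
      ≤ |s| + (s - x) ^ 2 / (2 * b) := by
  obtain ⟨g, hg, hgs, hx⟩ := exists_subgradient_softThresh x b hb
  generalize softThresh x b = m at *
  obtain rfl : x = m + b * g := by linarith
  have h1 : g * s ≤ |s| := by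
    calc g * s ≤ |g * s| := le_abs_self _
      _ = |g| * |s| := abs_mul _ _
      _ ≤ 1 * |s| := by gcongr
      _ = |s| := one_mul _
  have h2 : (s - (m + b * g)) ^ 2 / (2 * b)
      = (m - (m + b * g)) ^ 2 / (2 * b) + (s - m) ^ 2 / (2 * b) - g * (s - m) := by
    field_simp
    ring
  linarith

/-- Upper bound for `s ↦ |s| + (s - x)² / (2b)` near its minimizer. -/
theorem le_near_softThresh (x b s : ℝ) (hb : 0 < b) :
    |s| + (s - x) ^ 2 / (2 * b) ≤
      |softThresh x b| + (softThresh x b - x) ^ 2 / (2 * b)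
        + (2 * |s - softThresh x b| + (s - softThresh x b) ^ 2 / (2 * b)) := by
  obtain ⟨g, hg, hgs, hx⟩ := exists_subgradient_softThresh x b hb
  generalize softThresh x b = m at *
  obtain rfl : x = m + b * g := by linarith
  have h1 : -(g * (s - m)) ≤ |s - m| := by
    calc -(g * (s - m)) ≤ |g * (s - m)| := neg_le_abs _
      _ = |g| * |s - m| := abs_mul _ _
      _ ≤ 1 * |s - m| := by gcongr
      _ = |s - m| := one_mul _
  have h2 : (s - (m + b * g)) ^ 2 / (2 * b)
      = (m - (m + b * g)) ^ 2 / (2 * b) + (s - m) ^ 2 / (2 * b) - g * (s - m) := by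
    field_simp
    ring
  have h3 : |s| - |m| ≤ |s - m| := abs_sub_abs_le_abs_sub s m
  linarith

theorem ampWeight_eq (β x b s : ℝ) :
    ampWeight β x b s = Real.exp (-β * (|s| + (s - x) ^ 2 / (2 * b))) := by
  unfold ampWeight
  congr 1
  ring

theorem ampWeight_pos (β x b s : ℝ) : 0 < ampWeight β x b s := Real.exp_pos _

theorem integrable_gaussian_sub {c : ℝ} (hc : 0 < c) (m : ℝ) :
    Integrable (fun s : ℝ => Real.exp (-c * (s - m) ^ 2)) :=
  (integrable_exp_neg_mul_sq hc).comp_sub_right m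

theorem integrable_ampWeight {β b : ℝ} (x : ℝ) (hβ : 0 < β) (hb : 0 < b) :
    Integrable (ampWeight β x b) := by
  refine (integrable_gaussian_sub (c := β / (2 * b)) (by positivity) x).mono' ?_ ?_
  · unfold ampWeight
    exact (by fun_prop : Continuous _).aestronglyMeasurable
  · refine ae_of_all _ fun s => ?_
    rw [Real.norm_of_nonneg (ampWeight_pos β x b s).le]
    refine Real.exp_le_exp.2 ?_
    have : 0 ≤ β * |s| := by positivity
    linarith

/-- Gaussian tail bound for the unnormalized mass far from the minimizer. -/
theorem setIntegral_ampWeight_le {β b ε : ℝ} (x : ℝ) (hβ : 0 < β) (hb : 0 < b) (hε : 0 < ε) :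
    ∫ s in {s : ℝ | ε < |s - softThresh x b|}, ampWeight β x b s ≤
      Real.exp (-β * (|softThresh x b| + (softThresh x b - x) ^ 2 / (2 * b)))
        * Real.exp (-(ε ^ 2 / (4 * b)) * β) * √(Real.pi / (β / (4 * b))) := by
  have hgrow := fun s => quadratic_growth_softThresh x b s hb
  generalize softThresh x b = m at *
  have hc : 0 < β / (4 * b) := by positivity
  have hint := (integrable_gaussian_sub hc m).const_mul
    (Real.exp (-β * (|m| + (m - x) ^ 2 / (2 * b))) * Real.exp (-(ε ^ 2 / (4 * b)) * β))
  have hS : MeasurableSet {s : ℝ | ε < |s - m|} :=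
    measurableSet_lt measurable_const (by fun_prop)
  calc ∫ s in {s : ℝ | ε < |s - m|}, ampWeight β x b s
      ≤ ∫ s in {s : ℝ | ε < |s - m|},
          Real.exp (-β * (|m| + (m - x) ^ 2 / (2 * b))) * Real.exp (-(ε ^ 2 / (4 * b)) * β)
            * Real.exp (-(β / (4 * b)) * (s - m) ^ 2) := by
        refine setIntegral_mono_on (integrable_ampWeight x hβ hb).integrableOn
          hint.integrableOn hS fun s hs => ?_
        rw [ampWeight_eq, ← Real.exp_add, ← Real.exp_add]
        refine Real.exp_le_exp.2 ?_
        have hsq : ε ^ 2 ≤ (s - m) ^ 2 := by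
          rw [← sq_abs (s - m)]
          exact pow_le_pow_left₀ hε.le (le_of_lt hs) 2
        have h1 : β * (ε ^ 2 / (4 * b)) ≤ β * ((s - m) ^ 2 / (4 * b)) := by gcongr
        have h2 := mul_le_mul_of_nonneg_left (hgrow s) hβ.le
        have h3 : β * ((s - m) ^ 2 / (2 * b)) = 2 * (β * ((s - m) ^ 2 / (4 * b))) := by
          field_simp
          ring
        have h4 : β / (4 * b) * (s - m) ^ 2 = β * ((s - m) ^ 2 / (4 * b)) := by ring
        linarith
    _ ≤ ∫ s : ℝ, Real.exp (-β * (|m| + (m - x) ^ 2 / (2 * b)))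
          * Real.exp (-(ε ^ 2 / (4 * b)) * β) * Real.exp (-(β / (4 * b)) * (s - m) ^ 2) :=
        setIntegral_le_integral hint (ae_of_all _ fun s => by positivity)
    _ = _ := by
        rw [integral_const_mul,
          integral_sub_right_eq_self (fun s : ℝ => Real.exp (-(β / (4 * b)) * s ^ 2)) m,
          integral_gaussian]

/-- Lower bound for the normalizing constant from an interval of length `1 / β`. -/
theorem le_ampZ {β b : ℝ} (x : ℝ) (hβ : 1 ≤ β) (hb : 0 < b) :
    Real.exp (-β * (|softThresh x b| + (softThresh x b - x) ^ 2 / (2 * b)))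
      * Real.exp (-(2 + 1 / (2 * b))) * β⁻¹ ≤ ampZ β x b := by
  have hnear := fun s => le_near_softThresh x b s hb
  generalize softThresh x b = m at *
  have hβ0 : 0 < β := by linarith
  have hint := integrable_ampWeight x hβ0 hb
  calc _ = ∫ _ in Set.Icc m (m + β⁻¹),
          Real.exp (-β * (|m| + (m - x) ^ 2 / (2 * b))) * Real.exp (-(2 + 1 / (2 * b))) := by
        have : 0 ≤ β⁻¹ := by positivity
        simp [this, mul_comm]
    _ ≤ ∫ s in Set.Icc m (m + β⁻¹), ampWeight β x b s := by
        refine setIntegral_mono_on (integrableOn_const (by simp)) hint.integrableOn measurableSet_Icc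
          fun s hs => ?_
        rw [ampWeight_eq, ← Real.exp_add]
        refine Real.exp_le_exp.2 ?_
        have ht0 : 0 ≤ s - m := by linarith [hs.1]
        have ht1 : β * (s - m) ≤ 1 := by
          calc β * (s - m) ≤ β * β⁻¹ := by
                gcongr
                linarith [hs.2]
            _ = 1 := mul_inv_cancel₀ hβ0.ne'
        have ht2 : β * (s - m) ^ 2 ≤ 1 := by nlinarith
        have h1 : β * ((s - m) ^ 2 / (2 * b)) ≤ 1 / (2 * b) := by
          rw [← mul_div_assoc]
          gcongr
        have h2 := mul_le_mul_of_nonneg_left (hnear s) hβ0.le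
        rw [abs_of_nonneg ht0] at h2
        linarith
    _ ≤ ampZ β x b :=
        setIntegral_le_integral hint (ae_of_all _ fun s => (ampWeight_pos β x b s).le)

/-- Fix `x ∈ ℝ` and `b > 0`, and let `s* = η(x; b) = sign(x)·(|x| − b)₊`.  Then the
probability measures with density `f_β(·; x, b)` concentrate at `s*` as `β → ∞`:
for every `ε > 0`, the `f_β(·; x, b)`-probability of the set
`{s ∈ ℝ : |s − s*| > ε}` tends to `0` as `β → ∞`. -/
theorem amp_density_concentrates (x b : ℝ) (hb : 0 < b) (ε : ℝ) (hε : 0 < ε) :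
    Tendsto
      (fun β : ℝ =>
        (∫ s in {s : ℝ | ε < |s - softThresh x b|}, ampWeight β x b s) / ampZ β x b)
      atTop (nhds 0) := by
  have hlim : Tendsto (fun β : ℝ => √(4 * b * Real.pi) * Real.exp (2 + 1 / (2 * b))
      * (β ^ (1 : ℝ) * Real.exp (-(ε ^ 2 / (4 * b)) * β))) atTop (nhds 0) := by
    simpa using (tendsto_rpow_mul_exp_neg_mul_atTop_nhds_zero 1 (ε ^ 2 / (4 * b))
      (by positivity)).const_mul (√(4 * b * Real.pi) * Real.exp (2 + 1 / (2 * b)))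
  refine tendsto_of_tendsto_of_tendsto_of_le_of_le' tendsto_const_nhds hlim ?_ ?_
  · filter_upwards with β
    exact div_nonneg (integral_nonneg fun s => (ampWeight_pos β x b s).le)
      (integral_nonneg fun s => (ampWeight_pos β x b s).le)
  · filter_upwards [eventually_ge_atTop 1] with β hβ
    have hβ0 : 0 < β := by linarith
    have hZ := le_ampZ x hβ hb
    have hZ0 : 0 < ampZ β x b := lt_of_lt_of_le (by positivity) hZ
    have hsqrt : √(Real.pi / (β / (4 * b))) ≤ √(4 * b * Real.pi) := by
      refine Real.sqrt_le_sqrt ?_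
      rw [div_div_eq_mul_div, mul_comm]
      exact div_le_self (by positivity) hβ
    rw [div_le_iff₀ hZ0, Real.rpow_one]
    set A := Real.exp (-β * (|softThresh x b| + (softThresh x b - x) ^ 2 / (2 * b)))
    calc _ ≤ A * Real.exp (-(ε ^ 2 / (4 * b)) * β) * √(Real.pi / (β / (4 * b))) :=
          setIntegral_ampWeight_le x hβ0 hb hε
      _ ≤ A * Real.exp (-(ε ^ 2 / (4 * b)) * β) * √(4 * b * Real.pi) := by gcongr
      _ = √(4 * b * Real.pi) * Real.exp (2 + 1 / (2 * b))
            * (β * Real.exp (-(ε ^ 2 / (4 * b)) * β))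
            * (A * Real.exp (-(2 + 1 / (2 * b))) * β⁻¹) := by
          rw [Real.exp_neg (2 + 1 / (2 * b))]
          field_simp
      _ ≤ _ := by gcongr
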